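/- Let α, β be positive numbers, let y ∈ W^{1,1}([r₀, r₁], ℝ) satisfy y′ ≥ 0 almost everywhere, and let D ⊆ (r₀, r₁) be a measurable set with H¹(D) ≥ (r₁ − r₀)/2. If y(r) ≤ α · (y′(r))^{1/2} + β for H¹-almost every r ∈ D, then y(r₀) ≤ β + 2α²/(r₁ − r₀). -/

import Mathlib

open MeasureTheory Set

/-- A monotone function whose derivative is at least `c` almost everywhere on `D` grows by at
least `c` times the measure of `D`. -/
theorem MonotoneOn.mul_measureReal_le_sub {f : ℝ → ℝ} {a b c : ℝ} (hab : a ≤ b)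
    (hf : MonotoneOn f (Icc a b)) {D : Set ℝ} (hDsub : D ⊆ Ioo a b)
    (hc : ∀ᵐ x ∂volume.restrict D, c ≤ deriv f x) :
    c * volume.real D ≤ f b - f a := by
  have hfu : MonotoneOn f (uIcc a b) := by rwa [uIcc_of_le hab]
  have hint : IntegrableOn (deriv f) (Ioo a b) := by
    rw [← intervalIntegrable_iff_integrableOn_Ioo_of_le hab]
    exact hfu.intervalIntegrable_deriv
  have hnonneg : ∀ x ∈ Ioo a b, 0 ≤ deriv f x := fun x hx => by
    rw [← derivWithin_of_mem_nhds (Icc_mem_nhds hx.1 hx.2)]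
    exact hf.derivWithin_nonneg
  have hfin : volume D ≠ ⊤ := measure_ne_top_of_subset hDsub (by simp)
  calc c * volume.real D = ∫ _ in D, c := by simp [mul_comm]
    _ ≤ ∫ x in D, deriv f x :=
      setIntegral_mono_ae_restrict (integrableOn_const hfin) (hint.mono_set hDsub) hc
    _ ≤ ∫ x in Ioo a b, deriv f x :=
      setIntegral_mono_set hint (ae_restrict_of_forall_mem measurableSet_Ioo hnonneg)
        hDsub.eventuallyLE
    _ = ∫ x in a..b, deriv f x := by
      rw [intervalIntegral.integral_of_le hab, integral_Ioc_eq_integral_Ioo]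
    _ ≤ f b - f a := by
      have h := hfu.intervalIntegral_deriv_mem_uIcc
      rw [uIcc_of_le (sub_nonneg.2 (hf (left_mem_Icc.2 hab) (right_mem_Icc.2 hab) hab))] at h
      exact h.2

/-- An indefinite integral of an almost everywhere nonnegative function is monotone. -/
theorem monotoneOn_of_sub_eq_integral {y g : ℝ → ℝ} {a b : ℝ}
    (hftc : ∀ s t : ℝ, a ≤ s → s ≤ t → t ≤ b → y t - y s = ∫ u in s..t, g u)
    (hg0 : ∀ᵐ u ∂volume.restrict (Icc a b), 0 ≤ g u) :
    MonotoneOn y (Icc a b) := fun s hs t ht hst => by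
  rw [← sub_nonneg, hftc s t hs.1 hst ht.2]
  exact intervalIntegral.integral_nonneg_of_ae_restrict hst
    (ae_restrict_of_ae_restrict_of_subset (Icc_subset_Icc hs.1 ht.2) hg0)

/-- An indefinite integral of an integrable function is differentiable almost everywhere, with
the integrand as derivative. -/
theorem ae_hasDerivAt_of_sub_eq_integral {y g : ℝ → ℝ} {a b : ℝ} (hab : a ≤ b)
    (hgint : IntegrableOn g (Icc a b))
    (hftc : ∀ s t : ℝ, a ≤ s → s ≤ t → t ≤ b → y t - y s = ∫ u in s..t, g u) :
    ∀ᵐ x, x ∈ Ioo a b → HasDerivAt y (g x) x := by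
  have hii : IntervalIntegrable g volume a b := by
    rwa [intervalIntegrable_iff_integrableOn_Icc_of_le hab]
  filter_upwards [hii.ae_hasDerivAt_integral] with x hx hxI
  rw [uIcc_of_le hab] at hx
  refine ((hx (Ioo_subset_Icc_self hxI) a (left_mem_Icc.2 hab)).add_const
    (y a)).congr_of_eventuallyEq ?_
  filter_upwards [Icc_mem_nhds hxI.1 hxI.2] with t ht
  rw [← hftc a t le_rfl ht.1 ht.2, sub_add_cancel]

/-- the ODE lemma.  `y ∈ W^{1,1}([r₀, r₁])` is encoded as an (absolutely
continuous) function together with an integrable a.e. derivative `g` satisfying the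
fundamental theorem of calculus; `H¹` is one-dimensional Lebesgue measure. -/
theorem statement18 (r₀ r₁ α β : ℝ) (hr : r₀ < r₁) (hα : 0 < α) (hβ : 0 < β)
    (y g : ℝ → ℝ)
    (hgint : IntegrableOn g (Icc r₀ r₁))
    (hftc : ∀ s t : ℝ, r₀ ≤ s → s ≤ t → t ≤ r₁ → y t - y s = ∫ u in s..t, g u)
    (hg0 : ∀ᵐ u ∂volume.restrict (Icc r₀ r₁), 0 ≤ g u)
    (D : Set ℝ) (hD : MeasurableSet D) (hDsub : D ⊆ Ioo r₀ r₁)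
    (hDmeas : (r₁ - r₀) / 2 ≤ (volume D).toReal)
    (hineq : ∀ᵐ r ∂volume.restrict D, y r ≤ α * Real.sqrt (g r) + β) :
    y r₀ ≤ β + 2 * α ^ 2 / (r₁ - r₀) := by
  rcases le_or_gt (y r₀) β with hle | hlt
  · exact hle.trans (le_add_of_nonneg_right (div_nonneg (by positivity) (sub_pos.2 hr).le))
  have hmono := monotoneOn_of_sub_eq_integral hftc hg0
  have hz : ∀ r ∈ Icc r₀ r₁, 0 < y r - β := fun r hrI => by
    have := hmono (left_mem_Icc.2 hr.le) hrI hrI.1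
    linarith
  have hwmono : MonotoneOn (fun r => -(y r - β)⁻¹) (Icc r₀ r₁) := fun s hs t ht hst =>
    neg_le_neg (inv_anti₀ (hz s hs) (sub_le_sub_right (hmono hs ht hst) β))
  have hwderiv : ∀ᵐ r ∂volume.restrict D, (α ^ 2)⁻¹ ≤ deriv (fun r => -(y r - β)⁻¹) r := by
    filter_upwards [hineq, ae_restrict_of_ae (ae_hasDerivAt_of_sub_eq_integral hr.le hgint hftc),
      ae_restrict_mem hD] with r hyr hder hrD
    have hpos := hz r (Ioo_subset_Icc_self (hDsub hrD))
    have hder' : HasDerivAt (fun r => -(y r - β)⁻¹) (-(-g r / (y r - β) ^ 2)) r :=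
      (((hder (hDsub hrD)).sub_const β).inv hpos.ne').neg
    rw [hder'.deriv, neg_div, neg_neg,
      le_div_iff₀ (by positivity), inv_mul_le_iff₀ (by positivity)]
    have hsqrt : 0 < √(g r) := pos_of_mul_pos_right (by linarith) hα.le
    calc (y r - β) ^ 2 ≤ (α * √(g r)) ^ 2 := pow_le_pow_left₀ hpos.le (by linarith) 2
      _ = α ^ 2 * g r := by rw [mul_pow, Real.sq_sqrt (Real.sqrt_pos.1 hsqrt).le]
  have hgrowth := hwmono.mul_measureReal_le_sub hr.le hDsub hwderiv
  have hz₀ := hz r₀ (left_mem_Icc.2 hr.le)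
  have hz₁ := inv_pos.2 (hz r₁ (right_mem_Icc.2 hr.le))
  have hkey : (α ^ 2)⁻¹ * ((r₁ - r₀) / 2) ≤ (y r₀ - β)⁻¹ := by
    have := mul_le_mul_of_nonneg_left hDmeas (inv_nonneg.2 (sq_nonneg α))
    rw [Measure.real] at hgrowth
    linarith
  have hlen := sub_pos.2 hr
  have := inv_anti₀ (by positivity) hkey
  rw [inv_inv, mul_inv, inv_inv, inv_div, mul_div_assoc', mul_comm] at this
  linarith
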